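/- If Ψ > 4·k^{3/2}, then for every i ∈ {1,…,k} the vector ĝ_i = ∑_{j=1}^k β_j^{(i)} ḡ_j satisfies ‖f_i − ĝ_i‖² ≤ (1 + 3k/Ψ)·k/Ψ. -/

import Mathlib

open Finset BigOperators Matrix

namespace SpectralClustering

variable {V : Type} [Fintype V] [DecidableEq V]

/-- Volume of a vertex set: the sum of the degrees of its vertices. -/
def vol (G : SimpleGraph V) [DecidableRel G.Adj] (S : Finset V) : ℕ :=
  ∑ v ∈ S, G.degree v

/-- Number of edges between two (disjoint) vertex sets. -/
def cut (G : SimpleGraph V) [DecidableRel G.Adj] (S T : Finset V) : ℕ :=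
  ∑ u ∈ S, (T.filter fun v => G.Adj u v).card

/-- Conductance `φ(S) = |E(S, V \ S)| / μ(S)`. -/
noncomputable def conductance (G : SimpleGraph V) [DecidableRel G.Adj] (S : Finset V) : ℝ :=
  (cut G S Sᶜ : ℝ) / (vol G S : ℝ)

/-- A `k`-way partition of the vertex set into nonempty blocks. -/
def IsKWayPartition {k : ℕ} (P : Fin k → Finset V) : Prop :=
  (∀ i, (P i).Nonempty) ∧ (∀ i j, i ≠ j → Disjoint (P i) (P j)) ∧
    (∀ v : V, ∃ i, v ∈ P i)

/-- Maximum conductance over the blocks of a tuple of sets. -/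
noncomputable def maxCond (G : SimpleGraph V) [DecidableRel G.Adj] {k : ℕ}
    (P : Fin k → Finset V) : ℝ :=
  ⨆ i, conductance G (P i)

/-- Average conductance of the blocks. -/
noncomputable def avgCond (G : SimpleGraph V) [DecidableRel G.Adj] {k : ℕ}
    (P : Fin k → Finset V) : ℝ :=
  (∑ i, conductance G (P i)) / (k : ℝ)

/-- `P` achieves `ρ̂_avr(k)`: it minimizes the maximum conductance among all
`k`-way partitions, and among those it has minimal average conductance. -/
def AchievesRhoAvr (G : SimpleGraph V) [DecidableRel G.Adj] {k : ℕ}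
    (P : Fin k → Finset V) : Prop :=
  IsKWayPartition P ∧
  (∀ Q : Fin k → Finset V, IsKWayPartition Q → maxCond G P ≤ maxCond G Q) ∧
  (∀ Q : Fin k → Finset V, IsKWayPartition Q → maxCond G Q = maxCond G P →
    avgCond G P ≤ avgCond G Q)

/-- Dot product of two vectors indexed by the vertices. -/
def dotV (x y : V → ℝ) : ℝ := ∑ v, x v * y v

/-- The normalized Laplacian `I - D^{-1/2} A D^{-1/2}`. -/
noncomputable def normLap (G : SimpleGraph V) [DecidableRel G.Adj] : Matrix V V ℝ :=
  1 - Matrix.diagonal (fun v => (Real.sqrt (G.degree v))⁻¹) * G.adjMatrix ℝ *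
      Matrix.diagonal (fun v => (Real.sqrt (G.degree v))⁻¹)

/-- `f` is an orthonormal family of eigenvectors of the normalized Laplacian of `G`
with (sorted) eigenvalues `lam`. -/
structure EigenData (G : SimpleGraph V) [DecidableRel G.Adj]
    (f : Fin (Fintype.card V) → V → ℝ) (lam : Fin (Fintype.card V) → ℝ) : Prop where
  eig : ∀ i, (normLap G).mulVec (f i) = lam i • f i
  ortho : ∀ i j, dotV (f i) (f j) = if i = j then (1 : ℝ) else 0
  mono : Monotone lam

/-- The gap parameter `Ψ = λ_{k+1} / ρ̂_avr(k)`, where `ρ̂_avr(k)` is realized as the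
average conductance of the fixed optimal partition `P`. -/
noncomputable def Psi (G : SimpleGraph V) [DecidableRel G.Adj]
    (lam : Fin (Fintype.card V) → ℝ) {k : ℕ} (P : Fin k → Finset V)
    (hkn : k < Fintype.card V) : ℝ :=
  lam ⟨k, hkn⟩ / avgCond G P

/-- The spectral embedding `F(u) = d_u^{-1/2} (f_1(u), …, f_k(u))`. -/
noncomputable def Femb (G : SimpleGraph V) [DecidableRel G.Adj]
    (f : Fin (Fintype.card V) → V → ℝ) {k : ℕ} (hk : k ≤ Fintype.card V) (u : V) :
    Fin k → ℝ :=
  fun j => f (Fin.castLE hk j) u / Real.sqrt (G.degree u)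

/-- `k`-means cost of a clustering of the (degree-weighted) spectral embedding:
`∑_i ∑_{u ∈ A_i} d_u ‖F(u) - c_i‖²`. -/
noncomputable def kmCost (G : SimpleGraph V) [DecidableRel G.Adj]
    (f : Fin (Fintype.card V) → V → ℝ) {k : ℕ} (hk : k ≤ Fintype.card V) {ℓ : ℕ}
    (A : Fin ℓ → Finset V) (c : Fin ℓ → Fin k → ℝ) : ℝ :=
  ∑ i, ∑ u ∈ A i, (G.degree u : ℝ) * ∑ j, (Femb G f hk u j - c i j) ^ 2

/-- `Δ_ℓ(𝒳_V)`: the optimal `ℓ`-means cost of the spectral embedding multiset `𝒳_V`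
(which contains `d_u` copies of `F(u)` for every vertex `u`). -/
noncomputable def kmOpt (G : SimpleGraph V) [DecidableRel G.Adj]
    (f : Fin (Fintype.card V) → V → ℝ) {k : ℕ} (hk : k ≤ Fintype.card V) (ℓ : ℕ) : ℝ :=
  sInf { r : ℝ | ∃ (A : Fin ℓ → Finset V) (c : Fin ℓ → Fin k → ℝ),
    (∀ i j, i ≠ j → Disjoint (A i) (A j)) ∧ (∀ v : V, ∃ i, v ∈ A i) ∧
    r = kmCost G f hk A c }

/-- Normalized characteristic vector `ḡ_i = D^{1/2} χ_{P_i} / √μ(P_i)`. -/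
noncomputable def gbar (G : SimpleGraph V) [DecidableRel G.Adj] {k : ℕ}
    (P : Fin k → Finset V) (i : Fin k) : V → ℝ :=
  fun v => (if v ∈ P i then Real.sqrt (G.degree v) else 0) / Real.sqrt (vol G (P i))

/-- Coefficients `α_j^{(i)} = ⟨ḡ_i, f_j⟩` of `ḡ_i` in the eigenbasis. -/
noncomputable def alpha (G : SimpleGraph V) [DecidableRel G.Adj] {k : ℕ}
    (P : Fin k → Finset V) (f : Fin (Fintype.card V) → V → ℝ)
    (i : Fin k) (j : Fin (Fintype.card V)) : ℝ :=
  dotV (gbar G P i) (f j)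

/-- Projection `f̂_i = ∑_{j=1}^k α_j^{(i)} f_j` of `ḡ_i` onto the first `k` eigenvectors. -/
noncomputable def fhat (G : SimpleGraph V) [DecidableRel G.Adj] {k : ℕ}
    (P : Fin k → Finset V) (f : Fin (Fintype.card V) → V → ℝ) (i : Fin k) : V → ℝ :=
  fun v => ∑ j : Fin (Fintype.card V),
    if (j : ℕ) < k then alpha G P f i j * f j v else 0

/-- Estimation center `p^{(i)} = μ(P_i)^{-1/2} (β_i^{(1)}, …, β_i^{(k)})`;
here `beta i j` denotes `β_j^{(i)}`. -/
noncomputable def estCenter (G : SimpleGraph V) [DecidableRel G.Adj] {k : ℕ}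
    (P : Fin k → Finset V) (beta : Fin k → Fin k → ℝ) (i : Fin k) : Fin k → ℝ :=
  fun j => beta j i / Real.sqrt (vol G (P i))

omit [DecidableEq V] in
lemma dotV_comm (x y : V → ℝ) : dotV x y = dotV y x :=
  Finset.sum_congr rfl fun _ _ => mul_comm _ _

omit [DecidableEq V] in
lemma dotV_sum_right {ι : Type*} (s : Finset ι) (x : V → ℝ) (c : ι → ℝ) (y : ι → V → ℝ) :
    dotV x (fun v => ∑ i ∈ s, c i * y i v) = ∑ i ∈ s, c i * dotV x (y i) := by
  simp only [dotV, Finset.mul_sum]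
  rw [Finset.sum_comm]
  exact Finset.sum_congr rfl fun _ _ => Finset.sum_congr rfl fun _ _ => by ring

omit [DecidableEq V] in
lemma dotV_sub_left (x y z : V → ℝ) : dotV (x - y) z = dotV x z - dotV y z := by
  simp [dotV, sub_mul, Finset.sum_sub_distrib]

omit [DecidableEq V] in
lemma dotV_mulVec_comm {M : Matrix V V ℝ} (hM : Mᵀ = M) (x y : V → ℝ) :
    dotV (M.mulVec x) y = dotV x (M.mulVec y) := by
  change (M *ᵥ x) ⬝ᵥ y = x ⬝ᵥ (M *ᵥ y)
  rw [Matrix.dotProduct_mulVec, ← Matrix.mulVec_transpose, hM]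

lemma normLap_transpose (G : SimpleGraph V) [DecidableRel G.Adj] :
    (normLap G)ᵀ = normLap G := by
  simp [normLap, Matrix.transpose_mul, Matrix.mul_assoc]

/-- In terms of `y = D^{-1/2} x`, the Laplacian form is `∑ u ∼ v, (y u ^ 2 - y u * y v)`. -/
lemma dotV_normLap (G : SimpleGraph V) [DecidableRel G.Adj] (hd : ∀ v : V, 0 < G.degree v)
    (y : V → ℝ) :
    dotV (fun v => √(G.degree v) * y v) ((normLap G).mulVec fun v => √(G.degree v) * y v) =
      ∑ u, ∑ v, if G.Adj u v then y u ^ 2 - y u * y v else 0 := by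
  have hs : ∀ v, √(G.degree v : ℝ) ≠ 0 := fun v =>
    (Real.sqrt_pos.2 (by exact_mod_cast hd v)).ne'
  have hL : ∀ u, (normLap G).mulVec (fun v => √(G.degree v) * y v) u =
      √(G.degree u) * y u - (√(G.degree u))⁻¹ * ∑ v, if G.Adj u v then y v else 0 := by
    intro u
    rw [normLap, Matrix.sub_mulVec, Matrix.one_mulVec, Pi.sub_apply]
    congr 1
    simp only [Matrix.mulVec, dotProduct, Matrix.mul_diagonal, Matrix.diagonal_mul,
      SimpleGraph.adjMatrix_apply, Finset.mul_sum]
    refine Finset.sum_congr rfl fun v _ => ?_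
    split_ifs
    · field_simp [hs v]
    · simp
  refine Finset.sum_congr rfl fun u _ => ?_
  have hdeg : ∑ v, (if G.Adj u v then y u ^ 2 else 0) = G.degree u * y u ^ 2 := by
    rw [← Finset.sum_filter, Finset.sum_const, nsmul_eq_mul, ← SimpleGraph.neighborFinset_eq_filter,
      SimpleGraph.card_neighborFinset_eq_degree]
  have hsplit : ∀ v, (if G.Adj u v then y u ^ 2 - y u * y v else 0) =
      (if G.Adj u v then y u ^ 2 else 0) - y u * (if G.Adj u v then y v else 0) := by
    intro v
    split_ifs <;> simp
  simp only [hsplit, Finset.sum_sub_distrib, ← Finset.mul_sum, hdeg, hL]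
  rw [mul_sub]
  congr 1
  · rw [← Real.sq_sqrt (Nat.cast_nonneg (α := ℝ) (G.degree u)), Real.sqrt_sq (Real.sqrt_nonneg _)]
    ring
  · field_simp [hs u]

lemma dotV_normLap_nonneg (G : SimpleGraph V) [DecidableRel G.Adj]
    (hd : ∀ v : V, 0 < G.degree v) (x : V → ℝ) : 0 ≤ dotV x ((normLap G).mulVec x) := by
  have hx : x = fun v => √(G.degree v) * (x v / √(G.degree v)) := funext fun v =>
    (mul_div_cancel₀ _ (Real.sqrt_pos.2 (by exact_mod_cast hd v)).ne').symm
  rw [hx, dotV_normLap G hd]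
  set y := fun v => x v / √(G.degree v : ℝ)
  change 0 ≤ ∑ u, ∑ v, if G.Adj u v then y u ^ 2 - y u * y v else 0
  set S := ∑ u, ∑ v, if G.Adj u v then y u ^ 2 - y u * y v else 0
  have hswap : S = ∑ u, ∑ v, if G.Adj u v then y v ^ 2 - y v * y u else 0 := by
    rw [Finset.sum_comm]
    simp only [S, G.adj_comm]
  have hdouble : S + S = ∑ u, ∑ v, if G.Adj u v then (y u - y v) ^ 2 else 0 := by
    nth_rw 2 [hswap]
    simp only [S, ← Finset.sum_add_distrib]
    refine Finset.sum_congr rfl fun u _ => Finset.sum_congr rfl fun v _ => ?_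
    split_ifs <;> ring
  have : 0 ≤ S + S := hdouble ▸ Finset.sum_nonneg fun u _ => Finset.sum_nonneg fun v _ => by
    split_ifs <;> positivity
  linarith

omit [DecidableEq V] in
lemma vol_pos (G : SimpleGraph V) [DecidableRel G.Adj] (hd : ∀ v : V, 0 < G.degree v)
    {S : Finset V} (hS : S.Nonempty) : (0 : ℝ) < vol G S := by
  exact_mod_cast Finset.sum_pos (fun v _ => hd v) hS

lemma dotV_gbar_normLap (G : SimpleGraph V) [DecidableRel G.Adj]
    (hd : ∀ v : V, 0 < G.degree v) {k : ℕ} (P : Fin k → Finset V) (i : Fin k) :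
    dotV (gbar G P i) ((normLap G).mulVec (gbar G P i)) = conductance G (P i) := by
  have hg : gbar G P i = fun v => √(G.degree v) *
      ((if v ∈ P i then 1 else 0) / √(vol G (P i))) := by
    funext v
    simp only [gbar]
    split_ifs <;> simp [div_eq_mul_inv]
  rw [hg, dotV_normLap G hd, conductance, cut, Nat.cast_sum, Finset.sum_div,
    ← Finset.sum_filter_add_sum_filter_not univ (· ∈ P i), Finset.filter_univ_mem]
  rw [Finset.sum_eq_zero (s := univ.filter (· ∉ P i)), add_zero]
  · refine Finset.sum_congr rfl fun u hu => ?_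
    rw [Finset.card_filter, Nat.cast_sum, Finset.sum_div,
      ← Finset.sum_subset (Finset.subset_univ (P i)ᶜ)]
    · refine Finset.sum_congr rfl fun v hv => ?_
      rw [Finset.mem_compl] at hv
      simp only [hu, hv, if_true, if_false]
      split_ifs <;> simp
    · intro v _ hv
      rw [Finset.mem_compl, not_not] at hv
      simp [hu, hv, sq]
  · intro u hu
    simp [(Finset.mem_filter.1 hu).2]

lemma dotV_gbar (G : SimpleGraph V) [DecidableRel G.Adj] (hd : ∀ v : V, 0 < G.degree v)
    {k : ℕ} {P : Fin k → Finset V} (hP : IsKWayPartition P) (i j : Fin k) :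
    dotV (gbar G P i) (gbar G P j) = if i = j then 1 else 0 := by
  split_ifs with hij
  · subst hij
    have hpos := vol_pos G hd (hP.1 i)
    have hterm : ∀ v, gbar G P i v * gbar G P i v =
        (if v ∈ P i then (G.degree v : ℝ) else 0) / vol G (P i) := by
      intro v
      simp only [gbar, div_mul_div_comm, Real.mul_self_sqrt hpos.le]
      split_ifs <;> simp
    simp only [dotV, hterm, ← Finset.sum_div]
    rw [Finset.sum_ite_mem, Finset.univ_inter, ← Nat.cast_sum]
    exact div_self hpos.ne'
  · refine Finset.sum_eq_zero fun v _ => ?_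
    by_cases hv : v ∈ P i
    · simp [gbar, Finset.disjoint_left.1 (hP.2.1 i j hij) hv]
    · simp [gbar, hv]

section EigenData

variable {G : SimpleGraph V} [DecidableRel G.Adj] {f : Fin (Fintype.card V) → V → ℝ}
  {lam : Fin (Fintype.card V) → ℝ}

lemma EigenData.parseval (hf : EigenData G f lam) (x y : V → ℝ) :
    ∑ j, dotV x (f j) * dotV y (f j) = dotV x y := by
  have hF : Matrix.of f * (Matrix.of f)ᵀ = 1 := by
    ext i j
    simpa [Matrix.mul_apply, Matrix.one_apply, dotV] using hf.ortho i j
  have hF' : (Matrix.of f)ᵀ * Matrix.of f = 1 :=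
    (Matrix.mul_eq_one_comm_of_card_eq _ _ _ (by simp)).1 hF
  calc ∑ j, dotV x (f j) * dotV y (f j)
      = (Matrix.of f *ᵥ x) ⬝ᵥ (Matrix.of f *ᵥ y) := by
        simp only [dotV_comm x, dotV_comm y]; rfl
    _ = x ⬝ᵥ y := by
        rw [Matrix.dotProduct_mulVec, ← Matrix.mulVec_transpose, Matrix.mulVec_mulVec, hF',
          Matrix.one_mulVec]

lemma EigenData.energy (hf : EigenData G f lam) (x : V → ℝ) :
    dotV x ((normLap G).mulVec x) = ∑ j, lam j * dotV x (f j) ^ 2 := by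
  rw [← hf.parseval]
  refine Finset.sum_congr rfl fun j _ => ?_
  rw [dotV_mulVec_comm (normLap_transpose G), hf.eig]
  have : dotV x (lam j • f j) = lam j * dotV x (f j) := dotProduct_smul (lam j) x (f j)
  rw [this]
  ring

lemma EigenData.lam_nonneg (hf : EigenData G f lam) (hd : ∀ v : V, 0 < G.degree v)
    (j : Fin (Fintype.card V)) : 0 ≤ lam j := by
  have h := dotV_normLap_nonneg G hd (f j)
  rw [hf.energy] at h
  simpa [hf.ortho] using h

lemma EigenData.dotV_fhat (hf : EigenData G f lam) {k : ℕ} (P : Fin k → Finset V) (i : Fin k)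
    (m : Fin (Fintype.card V)) :
    dotV (fhat G P f i) (f m) = if (m : ℕ) < k then dotV (gbar G P i) (f m) else 0 := by
  have h : fhat G P f i = fun v => ∑ j : Fin (Fintype.card V),
      (if (j : ℕ) < k then alpha G P f i j else 0) * f j v := by
    funext v
    simp only [fhat, ite_mul, zero_mul]
  rw [h, dotV_comm, dotV_sum_right]
  simp [hf.ortho, alpha]

lemma EigenData.dotV_gbar_sub_fhat (hf : EigenData G f lam) {k : ℕ} (P : Fin k → Finset V)
    (i : Fin k) (m : Fin (Fintype.card V)) :
    dotV (gbar G P i - fhat G P f i) (f m) =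
      if (m : ℕ) < k then 0 else dotV (gbar G P i) (f m) := by
  rw [dotV_sub_left, hf.dotV_fhat]
  split_ifs <;> simp

/-- The part of `ḡ_i` outside the span of the first `k` eigenvectors is controlled by the
conductance of `P i`. -/
lemma EigenData.lam_mul_residual_le (hf : EigenData G f lam) (hd : ∀ v : V, 0 < G.degree v)
    {k : ℕ} (hkn : k < Fintype.card V) (P : Fin k → Finset V) (i : Fin k) :
    lam ⟨k, hkn⟩ * dotV (gbar G P i - fhat G P f i) (gbar G P i - fhat G P f i) ≤
      conductance G (P i) := by
  rw [← dotV_gbar_normLap G hd, hf.energy, ← hf.parseval, Finset.mul_sum]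
  refine Finset.sum_le_sum fun m _ => ?_
  rw [hf.dotV_gbar_sub_fhat]
  split_ifs with hm
  · simpa using mul_nonneg (hf.lam_nonneg hd m) (sq_nonneg _)
  · rw [← sq]
    exact mul_le_mul_of_nonneg_right (hf.mono (Fin.mk_le_of_le_val (not_lt.1 hm))) (sq_nonneg _)

end EigenData

lemma le_of_le_one_add_mul {e t : ℝ} (ht : t ≤ 2 / 3) (h : e ≤ (1 + e) * t) :
    e ≤ (1 + 3 * t) * t := by
  have : 0 ≤ t ^ 2 * (2 - 3 * t) := mul_nonneg (sq_nonneg _) (by linarith)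
  by_contra! hlt
  nlinarith

theorem ghat_close_to_eigenvector
    {V : Type} [Fintype V] [DecidableEq V] (G : SimpleGraph V) [DecidableRel G.Adj]
    (hd : ∀ v : V, 0 < G.degree v)
    {k : ℕ} (hkn : k < Fintype.card V)
    (f : Fin (Fintype.card V) → V → ℝ) (lam : Fin (Fintype.card V) → ℝ)
    (hf : EigenData G f lam)
    (P : Fin k → Finset V) (hP : AchievesRhoAvr G P)
    (beta : Fin k → Fin k → ℝ)
    (hbeta : ∀ i : Fin k,
      f (Fin.castLE hkn.le i) = fun v => ∑ j : Fin k, beta i j * fhat G P f j v)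
    (hPsi : Psi G lam P hkn > 4 * Real.sqrt ((k : ℝ) ^ 3)) :
    ∀ i : Fin k,
      ∑ v : V, (f (Fin.castLE hkn.le i) v - ∑ j : Fin k, beta i j * gbar G P j v) ^ 2 ≤
        (1 + 3 * (k : ℝ) / Psi G lam P hkn) * ((k : ℝ) / Psi G lam P hkn) := by
  intro i
  have hk : (0 : ℝ) < k := by exact_mod_cast i.pos
  have hk1 : (1 : ℝ) ≤ k := by exact_mod_cast i.pos
  set Ψ := Psi G lam P hkn with hΨ
  have hΨ4 : 4 * (k : ℝ) < Ψ := by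
    have : (k : ℝ) ≤ √((k : ℝ) ^ 3) :=
      Real.le_sqrt_of_sq_le (pow_le_pow_right₀ hk1 (by norm_num))
    linarith
  have hΨ0 : 0 < Ψ := by linarith
  have havg0 : 0 ≤ avgCond G P :=
    div_nonneg (Finset.sum_nonneg fun _ _ => by unfold conductance; positivity) hk.le
  have havg : 0 < avgCond G P := havg0.lt_of_ne' fun h => by simp [hΨ, Psi, h] at hΨ0
  have hlam : lam ⟨k, hkn⟩ = Ψ * avgCond G P := (div_mul_cancel₀ _ havg.ne').symm
  have hlam0 : 0 < lam ⟨k, hkn⟩ := hlam ▸ mul_pos hΨ0 havg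
  set r : Fin k → V → ℝ := fun j => gbar G P j - fhat G P f j with hr
  set b := beta i
  set w := f (Fin.castLE hkn.le i)
  have hw : dotV w w = 1 := by simp [w, hf.ortho]
  have hres : ∑ j, dotV (r j) (r j) ≤ k / Ψ := by
    have hcond : ∑ j, conductance G (P j) = k * avgCond G P := by
      rw [avgCond, mul_div_cancel₀ _ hk.ne']
    have h := Finset.sum_le_sum fun j (_ : j ∈ univ) => hf.lam_mul_residual_le hd hkn P j
    rw [← Finset.mul_sum, hcond, hlam] at h
    rw [le_div_iff₀ hΨ0]
    refine le_of_mul_le_mul_right ?_ havg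
    calc _ = Ψ * avgCond G P * ∑ j, dotV (r j) (r j) := by ring
      _ ≤ _ := h
  have hx : ∀ v, ∑ j, b j * gbar G P j v = w v + ∑ j, b j * r j v := by
    intro v
    simp only [w, hbeta i, ← Finset.sum_add_distrib, hr, Pi.sub_apply]
    exact Finset.sum_congr rfl fun j _ => by ring
  set e := ∑ v, (∑ j, b j * r j v) ^ 2
  have hgoal : ∑ v, (w v - ∑ j, b j * gbar G P j v) ^ 2 = e :=
    Finset.sum_congr rfl fun v _ => by rw [hx]; ring
  have horth : dotV w (fun v => ∑ j, b j * r j v) = 0 := by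
    rw [dotV_sum_right]
    refine Finset.sum_eq_zero fun j _ => ?_
    rw [dotV_comm, hf.dotV_gbar_sub_fhat]
    simp
  have hnorm : ∑ j, b j ^ 2 = 1 + e := by
    have hleft : dotV (fun v => ∑ j, b j * gbar G P j v) (fun v => ∑ j, b j * gbar G P j v) =
        ∑ j, b j ^ 2 := by
      rw [dotV_sum_right]
      refine Finset.sum_congr rfl fun j _ => ?_
      rw [dotV_comm, dotV_sum_right]
      simp [dotV_gbar G hd hP.1, sq]
    have hexp : dotV (fun v => w v + ∑ j, b j * r j v) (fun v => w v + ∑ j, b j * r j v) =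
        dotV w w + 2 * dotV w (fun v => ∑ j, b j * r j v) + e := by
      simp only [dotV, e, Finset.mul_sum (s := (univ : Finset V)), ← Finset.sum_add_distrib]
      exact Finset.sum_congr rfl fun v _ => by ring
    rw [← hleft, funext hx, hexp, hw, horth]
    ring
  have he : e ≤ (1 + e) * (k / Ψ) := by
    have he0 : 0 ≤ 1 + e := hnorm ▸ Finset.sum_nonneg fun _ _ => sq_nonneg _
    calc e ≤ ∑ v, (∑ j, b j ^ 2) * ∑ j, r j v ^ 2 :=
          Finset.sum_le_sum fun v _ => Finset.sum_mul_sq_le_sq_mul_sq _ _ _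
      _ = (1 + e) * ∑ j, dotV (r j) (r j) := by
          rw [← Finset.mul_sum, Finset.sum_comm, hnorm]
          simp only [dotV, sq]
      _ ≤ _ := mul_le_mul_of_nonneg_left hres he0
  have ht : (k : ℝ) / Ψ ≤ 2 / 3 := by
    rw [div_le_iff₀ hΨ0]
    linarith
  rw [hgoal, mul_div_assoc]
  exact le_of_le_one_add_mul ht he

end SpectralClustering
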